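/- Let A ∈ ℝ^{d₁×n} and B ∈ ℝ^{d₂×n} be nonzero matrices with columns a₁,…,aₙ and b₁,…,bₙ, such that for every i ∈ [n] at least one of aᵢ, bᵢ is nonzero, and define pᵢ = (‖aᵢ‖²/‖A‖_F² + ‖bᵢ‖²/‖B‖_F²)/2. Then for every i ∈ [n], ‖(1/pᵢ)·aᵢbᵢᵀ − ABᵀ‖ ≤ ‖A‖_F·‖B‖_F + ‖A‖·‖B‖, where ‖·‖ is the spectral norm. -/

import Mathlib

open Matrix MeasureTheory

/-- The spectral norm (ℓ₂ operator norm) of a real matrix. -/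
noncomputable def specNorm {d n : ℕ} (M : Matrix (Fin d) (Fin n) ℝ) : ℝ :=
  ‖LinearMap.toContinuousLinearMap (Matrix.toEuclideanLin M)‖

/-- The Frobenius norm of a real matrix. -/
noncomputable def frobNorm {d n : ℕ} (M : Matrix (Fin d) (Fin n) ℝ) : ℝ :=
  Real.sqrt (∑ i, ∑ j, (M i j) ^ 2)

/-- The stable rank of a matrix: `‖M‖_F² / ‖M‖²`. -/
noncomputable def srank {d n : ℕ} (M : Matrix (Fin d) (Fin n) ℝ) : ℝ :=
  frobNorm M ^ 2 / specNorm M ^ 2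

/-- The Euclidean norm of a vector (e.g. a column of a matrix). -/
noncomputable def colNorm {d : ℕ} (v : Fin d → ℝ) : ℝ := Real.sqrt (∑ i, v i ^ 2)

theorem colNorm_nonneg {d : ℕ} (v : Fin d → ℝ) : 0 ≤ colNorm v := Real.sqrt_nonneg _

theorem colNorm_eq_norm {d : ℕ} (v : Fin d → ℝ) : colNorm v = ‖WithLp.toLp 2 v‖ := by
  simp [colNorm, EuclideanSpace.norm_eq]

theorem frobNorm_pos {d n : ℕ} {M : Matrix (Fin d) (Fin n) ℝ} (hM : M ≠ 0) :
    0 < frobNorm M := by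
  obtain ⟨i, j, hij⟩ : ∃ i j, M i j ≠ 0 := by
    by_contra! h
    exact hM (Matrix.ext h)
  refine Real.sqrt_pos.mpr (Finset.sum_pos' (fun _ _ => by positivity)
    ⟨i, Finset.mem_univ i, Finset.sum_pos' (fun _ _ => by positivity)
      ⟨j, Finset.mem_univ j, by positivity⟩⟩)

theorem specNorm_vecMulVec_le {d₁ d₂ : ℕ} (u : Fin d₁ → ℝ) (v : Fin d₂ → ℝ) :
    specNorm (Matrix.vecMulVec u v) ≤ colNorm u * colNorm v := by
  refine ContinuousLinearMap.opNorm_le_bound _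
    (mul_nonneg (colNorm_nonneg u) (colNorm_nonneg v)) fun x => ?_
  have hx : Matrix.toEuclideanLin (Matrix.vecMulVec u v) x
      = inner ℝ (WithLp.toLp 2 v) x • WithLp.toLp 2 u := by
    ext k
    simp [Matrix.toLpLin_apply, Matrix.vecMulVec_mulVec, PiLp.inner_apply, dotProduct, mul_comm]
  rw [LinearMap.coe_toContinuousLinearMap', hx, norm_smul, colNorm_eq_norm, colNorm_eq_norm]
  nlinarith [norm_inner_le_norm (𝕜 := ℝ) (WithLp.toLp 2 v) x, norm_nonneg (WithLp.toLp 2 u)]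

section L2OpNorm

open scoped Matrix.Norms.L2Operator

theorem specNorm_eq_norm {d n : ℕ} (M : Matrix (Fin d) (Fin n) ℝ) : specNorm M = ‖M‖ := rfl

theorem specNorm_sub_le {d n : ℕ} (M N : Matrix (Fin d) (Fin n) ℝ) :
    specNorm (M - N) ≤ specNorm M + specNorm N := norm_sub_le M N

theorem specNorm_smul {d n : ℕ} (c : ℝ) (M : Matrix (Fin d) (Fin n) ℝ) :
    specNorm (c • M) = |c| * specNorm M := norm_smul c M

theorem specNorm_mul_transpose_le {d₁ d₂ n : ℕ} (A : Matrix (Fin d₁) (Fin n) ℝ)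
    (B : Matrix (Fin d₂) (Fin n) ℝ) : specNorm (A * Bᵀ) ≤ specNorm A * specNorm B := by
  have hB : ‖Bᵀ‖ = ‖B‖ := by
    rw [← Matrix.conjTranspose_eq_transpose_of_trivial, Matrix.l2_opNorm_conjTranspose]
  simpa only [specNorm_eq_norm, hB] using Matrix.l2_opNorm_mul A Bᵀ

end L2OpNorm

theorem one_div_half_sq_add_sq_mul_le {a b f g : ℝ} (hf : 0 < f) (hg : 0 < g) :
    1 / ((a ^ 2 / f ^ 2 + b ^ 2 / g ^ 2) / 2) * (a * b) ≤ f * g := by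
  have hab : a * b ≤ f * g * ((a ^ 2 / f ^ 2 + b ^ 2 / g ^ 2) / 2) := by
    calc a * b = f * g * (a / f * (b / g)) := by field_simp
      _ ≤ f * g * ((a ^ 2 / f ^ 2 + b ^ 2 / g ^ 2) / 2) := by
        gcongr
        rw [← div_pow, ← div_pow]
        linarith [two_mul_le_add_sq (a / f) (b / g)]
  rw [one_div_mul_eq_div]
  exact div_le_of_le_mul₀ (by positivity) (by positivity) hab

/-- Claim 1 (almost-sure bound): `‖(1/pᵢ)·aᵢbᵢᵀ − ABᵀ‖ ≤ ‖A‖_F‖B‖_F + ‖A‖‖B‖`. -/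
theorem stmt2 {d₁ d₂ n : ℕ}
    (A : Matrix (Fin d₁) (Fin n) ℝ) (B : Matrix (Fin d₂) (Fin n) ℝ)
    (hA : A ≠ 0) (hB : B ≠ 0)
    (hcol : ∀ i : Fin n, (fun k => A k i) ≠ 0 ∨ (fun k => B k i) ≠ 0)
    (p : Fin n → ℝ)
    (hp : ∀ i : Fin n, p i =
      (colNorm (A · i) ^ 2 / frobNorm A ^ 2 + colNorm (B · i) ^ 2 / frobNorm B ^ 2) / 2)
    (i : Fin n) :
    specNorm ((1 / p i) • Matrix.vecMulVec (A · i) (B · i) - A * Bᵀ)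
      ≤ frobNorm A * frobNorm B + specNorm A * specNorm B := by
  refine (specNorm_sub_le _ _).trans (add_le_add ?_ (specNorm_mul_transpose_le A B))
  have hp_nonneg : 0 ≤ 1 / p i := by
    rw [hp i]
    positivity
  rw [specNorm_smul, abs_of_nonneg hp_nonneg]
  refine (mul_le_mul_of_nonneg_left (specNorm_vecMulVec_le _ _) hp_nonneg).trans ?_
  rw [hp i]
  exact one_div_half_sq_add_sq_mul_le (frobNorm_pos hA) (frobNorm_pos hB)
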